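/- arXiv:2105.10681 — 2 statements merged into one kernel-verified Lean document; each statement's English description precedes it below -/
import Mathlib

section
/- Let X be a real Banach space and let F : [0,1] → (nonempty bounded subsets of X) be a Riemann integrable multifunction. Then its Riemann integral A = ∫₀¹ F(t) dt is a convex set. -/
open Pointwise

/-- A tagged partition of the interval `[0,1]`: subdivision points
`x 0 = 0 ≤ x 1 ≤ … ≤ x n = 1` together with tags `t i ∈ [x i, x (i+1)]`. -/
structure TaggedPartition where
  n : ℕ
  npos : 0 < n
  x : Fin (n + 1) → ℝ
  t : Fin n → ℝ
  mono : Monotone x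
  x_zero : x 0 = 0
  x_last : x (Fin.last n) = 1
  tag_mem : ∀ i : Fin n, t i ∈ Set.Icc (x i.castSucc) (x i.succ)

/-- The mesh `d(T)` of a tagged partition: the largest length of a subinterval. -/
noncomputable def TaggedPartition.mesh (T : TaggedPartition) : ℝ :=
  ⨆ i : Fin T.n, (T.x i.succ - T.x i.castSucc)

/-- The Riemann sum `S(F,T) = ∑ |Δ i| • F (t i)` of a multifunction `F`,
where the sum of sets is the Minkowski sum. -/
noncomputable def setRiemannSum {X : Type*} [NormedAddCommGroup X] [NormedSpace ℝ X]
    (F : ℝ → Set X) (T : TaggedPartition) : Set X :=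
  ∑ i : Fin T.n, (T.x i.succ - T.x i.castSucc) • F (T.t i)

/-- A closed bounded nonempty set `A` is the Riemann integral of the multifunction `F` if
the Riemann sums of `F` converge to `A` in the Hausdorff distance as the mesh tends to `0`. -/
def IsSetRiemannIntegral {X : Type*} [NormedAddCommGroup X] [NormedSpace ℝ X]
    (F : ℝ → Set X) (A : Set X) : Prop :=
  A.Nonempty ∧ IsClosed A ∧ Bornology.IsBounded A ∧
    ∀ ε > 0, ∃ δ > 0, ∀ T : TaggedPartition, T.mesh < δ →
      Metric.hausdorffDist (setRiemannSum F T) A < ε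

/-- A multifunction is Riemann integrable if it has a Riemann integral. -/
def SetRiemannIntegrable {X : Type*} [NormedAddCommGroup X] [NormedSpace ℝ X]
    (F : ℝ → Set X) : Prop :=
  ∃ A : Set X, IsSetRiemannIntegral F A

/-- `F` is a multifunction on `[0,1]` with nonempty bounded values. -/
def IsMultifunction {X : Type*} [NormedAddCommGroup X] (F : ℝ → Set X) : Prop :=
  ∀ t ∈ Set.Icc (0 : ℝ) 1, (F t).Nonempty ∧ Bornology.IsBounded (F t)

/-- The tagged partition with `n` subintervals whose points and tags are given by sequences. -/
def TaggedPartition.ofSeq (n : ℕ) (hn : 0 < n) (x t : ℕ → ℝ) (h0 : x 0 = 0) (h1 : x n = 1)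
    (ht : ∀ i, t i ∈ Set.Icc (x i) (x (i + 1))) : TaggedPartition where
  n := n
  npos := hn
  x i := x i
  t i := t i
  mono := (monotone_nat_of_le_succ fun i => (ht i).1.trans (ht i).2).comp fun _ _ h => h
  x_zero := h0
  x_last := h1
  tag_mem i := ht i

theorem TaggedPartition.mesh_ofSeq_le {n : ℕ} {hn : 0 < n} {x t : ℕ → ℝ} {h0 : x 0 = 0}
    {h1 : x n = 1} {ht : ∀ i, t i ∈ Set.Icc (x i) (x (i + 1))} {c : ℝ}
    (hc : ∀ i, x (i + 1) - x i ≤ c) :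
    (TaggedPartition.ofSeq n hn x t h0 h1 ht).mesh ≤ c := by
  have : Nonempty (Fin (TaggedPartition.ofSeq n hn x t h0 h1 ht).n) := ⟨⟨0, hn⟩⟩
  exact ciSup_le fun i => hc i

theorem TaggedPartition.tag_mem_unitInterval (T : TaggedPartition) (i : Fin T.n) :
    T.t i ∈ Set.Icc (0 : ℝ) 1 := by
  have h := T.tag_mem i
  have h0 := T.mono (Fin.zero_le i.castSucc)
  have h1 := T.mono (Fin.le_last i.succ)
  rw [T.x_zero] at h0
  rw [T.x_last] at h1
  exact ⟨h0.trans h.1, h.2.trans h1⟩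

theorem Finset.sum_range_two_mul_eq_sum_add {M : Type*} [AddCommMonoid M] (f : ℕ → M) (n : ℕ) :
    ∑ i ∈ Finset.range (2 * n), f i = ∑ i ∈ Finset.range n, (f (2 * i) + f (2 * i + 1)) := by
  induction n with
  | zero => simp
  | succ n ih =>
    rw [Nat.mul_succ, Finset.sum_range_succ, Finset.sum_range_succ, ih, Finset.sum_range_succ,
      add_assoc]

section

variable {X : Type*} [NormedAddCommGroup X] [NormedSpace ℝ X] {F : ℝ → Set X}

theorem setRiemannSum_ofSeq (F : ℝ → Set X) {n : ℕ} {hn : 0 < n} {x t : ℕ → ℝ} {h0 : x 0 = 0}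
    {h1 : x n = 1} {ht : ∀ i, t i ∈ Set.Icc (x i) (x (i + 1))} :
    setRiemannSum F (TaggedPartition.ofSeq n hn x t h0 h1 ht) =
      ∑ i ∈ Finset.range n, (x (i + 1) - x i) • F (t i) :=
  Fin.sum_univ_eq_sum_range (fun i => (x (i + 1) - x i) • F (t i)) n

theorem IsMultifunction.setRiemannSum_nonempty_isBounded (hF : IsMultifunction F)
    (T : TaggedPartition) :
    (setRiemannSum F T).Nonempty ∧ Bornology.IsBounded (setRiemannSum F T) := by
  refine Finset.sum_induction _ (fun S : Set X => S.Nonempty ∧ Bornology.IsBounded S)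
    (fun S S' h h' => ⟨h.1.add h'.1, h.2.add h'.2⟩)
    ⟨Set.zero_nonempty, Bornology.isBounded_singleton⟩ fun i _ => ?_
  obtain ⟨hne, hb⟩ := hF _ (T.tag_mem_unitInterval i)
  exact ⟨hne.smul_set, hb.smul₀ _⟩

/-- There are arbitrarily fine pairs of tagged partitions whose second Riemann sum contains
all the convex combinations, with given weights, of elements of the first one. -/
theorem exists_smul_setRiemannSum_add_eq (F : ℝ → Set X) {a b : ℝ} (ha : 0 ≤ a) (hb : 0 ≤ b)
    (hab : a + b = 1) {δ : ℝ} (hδ : 0 < δ) :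
    ∃ T T' : TaggedPartition, T.mesh < δ ∧ T'.mesh < δ ∧
      a • setRiemannSum F T + b • setRiemannSum F T = setRiemannSum F T' := by
  obtain ⟨m, hm⟩ := exists_nat_one_div_lt hδ
  set c : ℝ := 1 / ((m : ℝ) + 1) with hc
  have hm0 : (0 : ℝ) < m + 1 := by positivity
  have hc0 : 0 < c := by positivity
  have hcm : ((m : ℝ) + 1) * c = 1 := by rw [hc]; field_simp
  have hac : 0 ≤ a * c := by positivity
  have hbc : 0 ≤ b * c := by positivity
  have habc : a * c + b * c = c := by rw [← add_mul, hab, one_mul]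
  let s : ℕ → ℝ := fun i => (i + a) * c
  let x : ℕ → ℝ := fun k => if k % 2 = 0 then (k / 2 : ℕ) * c else s (k / 2)
  have x_even (i : ℕ) : x (2 * i) = i * c := by simp [x]
  have x_odd (i : ℕ) : x (2 * i + 1) = s i := by
    have h1 : (2 * i + 1) % 2 = 1 := by omega
    have h2 : (2 * i + 1) / 2 = i := by omega
    simp [x, h1, h2]
  have x_even' (i : ℕ) : x (2 * i + 1 + 1) = (i + 1) * c := by
    have := x_even (i + 1)
    push_cast at this
    exact this
  have half_even (i : ℕ) : 2 * i / 2 = i := by omega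
  have half_odd (i : ℕ) : (2 * i + 1) / 2 = i := by omega
  have hT (i : ℕ) : s i ∈ Set.Icc ((i : ℝ) * c) ((i + 1 : ℕ) * c) := by
    push_cast
    constructor <;> simp only [s] <;> nlinarith
  have hT' (k : ℕ) : s (k / 2) ∈ Set.Icc (x k) (x (k + 1)) := by
    obtain ⟨i, rfl | rfl⟩ := Nat.even_or_odd' k
    · rw [half_even, x_even, x_odd]
      exact ⟨(hT i).1, le_rfl⟩
    · rw [half_odd, x_odd, x_even']
      exact ⟨le_rfl, by simpa using (hT i).2⟩
  refine ⟨.ofSeq (m + 1) m.succ_pos (fun i => i * c) s (by simp) (by simpa using hcm) hT,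
    .ofSeq (2 * (m + 1)) (by omega) x (fun k => s (k / 2)) (by simpa using x_even 0)
      (by rw [x_even]; simpa using hcm) hT',
    (TaggedPartition.mesh_ofSeq_le fun i => ?_).trans_lt hm,
    (TaggedPartition.mesh_ofSeq_le fun k => ?_).trans_lt hm, ?_⟩
  · push_cast
    linarith
  · obtain ⟨i, rfl | rfl⟩ := Nat.even_or_odd' k
    · rw [x_even, x_odd]
      simp only [s]
      linarith
    · rw [x_odd, x_even']
      simp only [s]
      linarith
  · rw [setRiemannSum_ofSeq, setRiemannSum_ofSeq, Finset.sum_range_two_mul_eq_sum_add,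
      Finset.smul_sum, Finset.smul_sum, ← Finset.sum_add_distrib]
    refine Finset.sum_congr rfl fun i _ => ?_
    rw [half_even, half_odd, x_even, x_odd, x_even', smul_smul, smul_smul]
    congr 2
    · push_cast
      simp only [s]
      ring
    · push_cast
      simp only [s]
      linear_combination habc

end

/-- The Riemann integral of any Riemann integrable multifunction is convex. -/
theorem stmt4 {X : Type*} [NormedAddCommGroup X] [NormedSpace ℝ X] [CompleteSpace X]
    (F : ℝ → Set X) (hF : IsMultifunction F) (A : Set X)
    (hFA : IsSetRiemannIntegral F A) :
    Convex ℝ A := by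
  obtain ⟨hne, hcl, hbd, hlim⟩ := hFA
  intro u hu v hv a b ha hb hab
  rw [← hcl.closure_eq, Metric.mem_closure_iff]
  intro ε hε
  obtain ⟨δ, hδ, hδT⟩ := hlim (ε / 2) (half_pos hε)
  obtain ⟨T, T', hT, hT', hTT'⟩ := exists_smul_setRiemannSum_add_eq F ha hb hab hδ
  have hfin (T : TaggedPartition) : Metric.hausdorffEDist (setRiemannSum F T) A ≠ ⊤ :=
    Metric.hausdorffEDist_ne_top_of_nonempty_of_bounded
      (hF.setRiemannSum_nonempty_isBounded T).1 hne
      (hF.setRiemannSum_nonempty_isBounded T).2 hbd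
  obtain ⟨p, hp, hpu⟩ := Metric.exists_dist_lt_of_hausdorffDist_lt' hu (hδT T hT) (hfin T)
  obtain ⟨q, hq, hqv⟩ := Metric.exists_dist_lt_of_hausdorffDist_lt' hv (hδT T hT) (hfin T)
  have hmem : a • p + b • q ∈ setRiemannSum F T' :=
    hTT' ▸ Set.add_mem_add (Set.smul_mem_smul_set hp) (Set.smul_mem_smul_set hq)
  obtain ⟨w, hw, hwd⟩ := Metric.exists_dist_lt_of_hausdorffDist_lt hmem (hδT T' hT') (hfin T')
  refine ⟨w, hw, ?_⟩
  have hcomb : dist (a • u + b • v) (a • p + b • q) ≤ ε / 2 := by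
    refine (dist_add_add_le _ _ _ _).trans ?_
    rw [dist_smul₀, dist_smul₀, Real.norm_of_nonneg ha, Real.norm_of_nonneg hb,
      dist_comm u, dist_comm v]
    nlinarith
  linarith [dist_triangle (a • u + b • v) (a • p + b • q) w]
end

section
/- Let p > 1, C > 0, and let X be a real Banach space of infratype p with constant C. Let F : [0,1] → (nonempty bounded subsets of X) be a multifunction such that conv F : t ↦ conv(F(t)) is Riemann integrable with ∫₀¹ conv F(t) dt = A. Then F is Riemann integrable and ∫₀¹ F(t) dt = A. -/
open Pointwise

/-- `X` has infratype `p` with constant `C`: for every finite collection of vectors one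
can choose signs `±1` so that `‖∑ αᵢ xᵢ‖ ≤ C (∑ ‖xᵢ‖^p)^{1/p}`. -/
def HasInfratype (X : Type*) [NormedAddCommGroup X] [NormedSpace ℝ X] (p C : ℝ) : Prop :=
  ∀ (n : ℕ) (x : Fin n → X), ∃ α : Fin n → ℝ, (∀ i, α i = 1 ∨ α i = -1) ∧
    ‖∑ i, α i • x i‖ ≤ C * (∑ i, ‖x i‖ ^ p) ^ (1 / p)

/-- A closed set that contains the midpoint of any two of its points is convex. -/
theorem convex_of_isClosed_of_midpoint {X : Type*} [NormedAddCommGroup X] [NormedSpace ℝ X]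
    {E : Set X} (hE : IsClosed E) (hmid : ∀ x ∈ E, ∀ y ∈ E, (1 / 2 : ℝ) • (x + y) ∈ E) :
    Convex ℝ E := by
  rw [convex_iff_segment_subset]
  intro x hx y hy z hz
  rw [segment_eq_image_lineMap] at hz
  obtain ⟨t, ⟨ht0, ht1⟩, rfl⟩ := hz
  let T : Set ℝ := {s | AffineMap.lineMap x y s ∈ E}
  have hT : IsClosed T := hE.preimage (by fun_prop)
  have hTmid : ∀ a ∈ T, ∀ b ∈ T, (a + b) / 2 ∈ T := by
    intro a ha b hb
    have h := hmid _ ha _ hb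
    simp only [T, Set.mem_ofPred_eq]
    convert h using 1
    simp only [AffineMap.lineMap_apply_module]
    module
  have h0 : (0 : ℝ) ∈ T := by simpa [T] using hx
  have h1 : (1 : ℝ) ∈ T := by simpa [T] using hy
  by_contra hcon
  have htT : t ∉ T := hcon
  have hAb : BddAbove (T ∩ Set.Iic t) := ⟨t, fun s hs => hs.2⟩
  have hBb : BddBelow (T ∩ Set.Ici t) := ⟨t, fun s hs => hs.2⟩
  have ha := (hT.inter isClosed_Iic).csSup_mem ⟨0, h0, ht0⟩ hAb
  have hb := (hT.inter isClosed_Ici).csInf_mem ⟨1, h1, ht1⟩ hBb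
  set a := sSup (T ∩ Set.Iic t) with ha_def
  set b := sInf (T ∩ Set.Ici t) with hb_def
  have hat : a < t := lt_of_le_of_ne ha.2 fun h => htT (h ▸ ha.1)
  have htb : t < b := lt_of_le_of_ne hb.2 fun h => htT (h ▸ hb.1)
  have hm := hTmid a ha.1 b hb.1
  rcases le_total ((a + b) / 2) t with h | h
  · have : (a + b) / 2 ≤ a := le_csSup hAb ⟨hm, h⟩
    linarith
  · have : b ≤ (a + b) / 2 := csInf_le hBb ⟨hm, h⟩
    linarith

/-- The points obtained from `S` by taking midpoints `n` times. -/
def iteratedMidpoints {X : Type*} [NormedAddCommGroup X] [NormedSpace ℝ X] (S : Set X) :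
    ℕ → Set X
  | 0 => S
  | n + 1 => {z | ∃ x ∈ iteratedMidpoints S n, ∃ y ∈ iteratedMidpoints S n,
      z = (1 / 2 : ℝ) • (x + y)}

theorem iteratedMidpoints_monotone {X : Type*} [NormedAddCommGroup X] [NormedSpace ℝ X]
    (S : Set X) : Monotone (iteratedMidpoints S) := by
  refine monotone_nat_of_le_succ fun n x hx => ⟨x, hx, x, hx, ?_⟩
  module

theorem convexHull_subset_closure_iteratedMidpoints {X : Type*} [NormedAddCommGroup X]
    [NormedSpace ℝ X] (S : Set X) :
    convexHull ℝ S ⊆ closure (⋃ n, iteratedMidpoints S n) := by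
  refine convexHull_min ?_ (convex_of_isClosed_of_midpoint isClosed_closure ?_)
  · exact (Set.subset_iUnion (iteratedMidpoints S) 0).trans subset_closure
  · intro x hx y hy
    refine map_mem_closure₂ (f := fun x y : X => (1 / 2 : ℝ) • (x + y)) (by fun_prop) hx hy ?_
    intro u hu v hv
    obtain ⟨m, hm⟩ := Set.mem_iUnion.1 hu
    obtain ⟨n, hn⟩ := Set.mem_iUnion.1 hv
    exact Set.mem_iUnion.2 ⟨max m n + 1,
      u, iteratedMidpoints_monotone S (le_max_left _ _) hm,
      v, iteratedMidpoints_monotone S (le_max_right _ _) hn, rfl⟩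

theorem HasInfratype.exists_signs {X : Type*} [NormedAddCommGroup X] [NormedSpace ℝ X]
    {p C : ℝ} (hX : HasInfratype X p C) {ι : Type*} [Fintype ι] (x : ι → X) :
    ∃ α : ι → ℝ, (∀ i, α i = 1 ∨ α i = -1) ∧
      ‖∑ i, α i • x i‖ ≤ C * (∑ i, ‖x i‖ ^ p) ^ (1 / p) := by
  let e := Fintype.equivFin ι
  obtain ⟨α, hα, h⟩ := hX (Fintype.card ι) (x ∘ e.symm)
  refine ⟨α ∘ e, fun i => hα _, ?_⟩
  rw [← e.symm.sum_comp, ← e.symm.sum_comp]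
  simpa using h

/-- The constant in the Shapley–Folkman type estimate for spaces of infratype `p`. -/
noncomputable def infratypeConvexConst (p C : ℝ) : ℝ :=
  C / (1 - (2 * (1 / 2 : ℝ) ^ p) ^ (1 / p))

theorem infratypeConvexConst_pos {p C : ℝ} (hp : 1 < p) (hC : 0 < C) :
    0 < infratypeConvexConst p C ∧
      C + infratypeConvexConst p C * (2 * (1 / 2 : ℝ) ^ p) ^ (1 / p) =
        infratypeConvexConst p C := by
  have h1 : (2 * (1 / 2 : ℝ) ^ p) < 1 := by
    have : (1 / 2 : ℝ) ^ p < (1 / 2 : ℝ) ^ (1 : ℝ) :=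
      Real.rpow_lt_rpow_of_exponent_gt (by norm_num) (by norm_num) hp
    rw [Real.rpow_one] at this
    linarith
  have h2 : (2 * (1 / 2 : ℝ) ^ p) ^ (1 / p) < 1 :=
    Real.rpow_lt_one (by positivity) h1 (by positivity)
  have h3 : 0 < 1 - (2 * (1 / 2 : ℝ) ^ p) ^ (1 / p) := by linarith
  refine ⟨div_pos hC h3, ?_⟩
  rw [infratypeConvexConst]
  field_simp
  ring

theorem HasInfratype.exists_near_iteratedMidpoints {X : Type*} [NormedAddCommGroup X]
    [NormedSpace ℝ X] {p C : ℝ} (hp : 1 < p) (hC : 0 < C) (hX : HasInfratype X p C)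
    {D : ℝ} (hD : 0 ≤ D) (n : ℕ) {ι : Type*} [Fintype ι] (S : ι → Set X)
    (hS : ∀ i, ∀ x ∈ S i, ∀ y ∈ S i, ‖x - y‖ ≤ D) (c : ι → ℝ) (hc : ∀ i, 0 ≤ c i)
    (y : ι → X) (hy : ∀ i, y i ∈ iteratedMidpoints (S i) n) :
    ∃ f : ι → X, (∀ i, f i ∈ S i) ∧
      ‖∑ i, c i • (y i - f i)‖ ≤ infratypeConvexConst p C * D * (∑ i, c i ^ p) ^ (1 / p) := by
  have hp0 : 0 < p := by linarith
  obtain ⟨hK, hKC⟩ := infratypeConvexConst_pos hp hC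
  induction n generalizing ι with
  | zero =>
    refine ⟨y, hy, ?_⟩
    have : 0 ≤ ∑ i, c i ^ p := Finset.sum_nonneg fun i _ => Real.rpow_nonneg (hc i) p
    simp only [sub_self, smul_zero, Finset.sum_const_zero, norm_zero]
    positivity
  | succ n ih =>
    choose u hu v hv huv using hy
    obtain ⟨g, hg, hgle⟩ := ih (ι := ι × Bool) (fun i => S i.1) (fun i => hS i.1)
      (fun i => c i.1 * (1 / 2)) (fun i => mul_nonneg (hc _) (by norm_num))
      (fun i => if i.2 then u i.1 else v i.1)
      (by rintro ⟨i, _ | _⟩ <;> simp [hu, hv])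
    obtain ⟨α, hα, hαle⟩ := hX.exists_signs
      (fun i => (c i * (1 / 2)) • (g (i, true) - g (i, false)))
    have hR : 0 ≤ ∑ i, c i ^ p := Finset.sum_nonneg fun i _ => Real.rpow_nonneg (hc i) p
    have hsum : (∑ i : ι × Bool, (c i.1 * (1 / 2)) ^ p) =
        (2 * (1 / 2 : ℝ) ^ p) * ∑ i, c i ^ p := by
      rw [Fintype.sum_prod_type, Finset.mul_sum]
      refine Finset.sum_congr rfl fun i _ => ?_
      rw [Fintype.sum_bool, Real.mul_rpow (hc i) (by norm_num)]
      ring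
    have hle2 : (∑ i, ‖(c i * (1 / 2)) • (g (i, true) - g (i, false))‖ ^ p) ^ (1 / p) ≤
        D * (∑ i, c i ^ p) ^ (1 / p) := by
      have : ∑ i, ‖(c i * (1 / 2)) • (g (i, true) - g (i, false))‖ ^ p ≤
          D ^ p * ∑ i, c i ^ p := by
        rw [Finset.mul_sum]
        refine Finset.sum_le_sum fun i _ => ?_
        rw [← Real.mul_rpow hD (hc i)]
        refine Real.rpow_le_rpow (norm_nonneg _) ?_ hp0.le
        have h1 := hS i _ (hg (i, true)) _ (hg (i, false))
        rw [norm_smul, Real.norm_of_nonneg (mul_nonneg (hc i) (by norm_num))]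
        nlinarith [mul_le_mul_of_nonneg_left h1 (hc i), mul_nonneg hD (hc i)]
      calc _ ≤ (D ^ p * ∑ i, c i ^ p) ^ (1 / p) :=
            Real.rpow_le_rpow (Finset.sum_nonneg fun i _ => by positivity) this (by positivity)
        _ = D * (∑ i, c i ^ p) ^ (1 / p) := by
            rw [Real.mul_rpow (by positivity) hR, one_div, Real.rpow_rpow_inv hD hp0.ne']
    refine ⟨fun i => if α i = 1 then g (i, false) else g (i, true),
      fun i => by dsimp only; split_ifs <;> exact hg (i, _), ?_⟩
    have hsplit : ∑ i, c i • (y i - if α i = 1 then g (i, false) else g (i, true)) =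
        (∑ i : ι × Bool, (c i.1 * (1 / 2)) • ((if i.2 then u i.1 else v i.1) - g i)) +
        ∑ i, α i • (c i * (1 / 2)) • (g (i, true) - g (i, false)) := by
      rw [Fintype.sum_prod_type, ← Finset.sum_add_distrib]
      refine Finset.sum_congr rfl fun i _ => ?_
      rw [Fintype.sum_bool, huv i]
      rcases hα i with h | h
      · simp only [h, if_true]
        simp only [Bool.false_eq_true, if_false]
        module
      · have : ¬ ((-1 : ℝ) = 1) := by norm_num
        simp only [h, this, if_true, Bool.false_eq_true, if_false]
        module
    rw [hsplit]
    rw [hsum, Real.mul_rpow (by positivity) hR] at hgle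
    set R := (∑ i, c i ^ p) ^ (1 / p)
    set K := infratypeConvexConst p C
    calc _ ≤ K * D * ((2 * (1 / 2 : ℝ) ^ p) ^ (1 / p) * R) + C * (D * R) :=
          (norm_add_le _ _).trans
            (add_le_add hgle (hαle.trans (mul_le_mul_of_nonneg_left hle2 hC.le)))
      _ = (C + K * (2 * (1 / 2 : ℝ) ^ p) ^ (1 / p)) * D * R := by ring
      _ = K * D * R := by rw [hKC]

/-- In a space of infratype `p > 1`, a Minkowski combination of convex hulls is close to the
Minkowski combination of the sets themselves. -/
theorem HasInfratype.exists_near_convexHull {X : Type*} [NormedAddCommGroup X]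
    [NormedSpace ℝ X] {p C : ℝ} (hp : 1 < p) (hC : 0 < C) (hX : HasInfratype X p C)
    {D : ℝ} (hD : 0 ≤ D) {ι : Type*} [Fintype ι] (S : ι → Set X)
    (hS : ∀ i, ∀ x ∈ S i, ∀ y ∈ S i, ‖x - y‖ ≤ D) (c : ι → ℝ) (hc : ∀ i, 0 ≤ c i)
    (y : ι → X) (hy : ∀ i, y i ∈ convexHull ℝ (S i)) {η : ℝ} (hη : 0 < η) :
    ∃ f : ι → X, (∀ i, f i ∈ S i) ∧ ‖∑ i, c i • (y i - f i)‖ ≤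
      η * ∑ i, c i + infratypeConvexConst p C * D * (∑ i, c i ^ p) ^ (1 / p) := by
  have h : ∀ i, ∃ z n, z ∈ iteratedMidpoints (S i) n ∧ dist (y i) z < η := by
    intro i
    obtain ⟨z, hz, hd⟩ := Metric.mem_closure_iff.1
      (convexHull_subset_closure_iteratedMidpoints (S i) (hy i)) η hη
    obtain ⟨n, hn⟩ := Set.mem_iUnion.1 hz
    exact ⟨z, n, hn, hd⟩
  choose z n hz hd using h
  obtain ⟨f, hf, hle⟩ := hX.exists_near_iteratedMidpoints hp hC hD (Finset.univ.sup n) S hS c hc z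
    (fun i => iteratedMidpoints_monotone _ (Finset.le_sup (Finset.mem_univ i)) (hz i))
  refine ⟨f, hf, ?_⟩
  have hsplit : ∑ i, c i • (y i - f i) = ∑ i, c i • (y i - z i) + ∑ i, c i • (z i - f i) := by
    rw [← Finset.sum_add_distrib]
    exact Finset.sum_congr rfl fun i _ => by module
  rw [hsplit]
  refine (norm_add_le _ _).trans (add_le_add ?_ hle)
  rw [Finset.mul_sum]
  refine (norm_sum_le _ _).trans (Finset.sum_le_sum fun i _ => ?_)
  rw [norm_smul, Real.norm_of_nonneg (hc i), ← dist_eq_norm, mul_comm]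
  exact mul_le_mul_of_nonneg_right (hd i).le (hc i)

theorem mem_setRiemannSum {X : Type*} [NormedAddCommGroup X] [NormedSpace ℝ X]
    {F : ℝ → Set X} {T : TaggedPartition} {x : X} :
    x ∈ setRiemannSum F T ↔ ∃ f : Fin T.n → X, (∀ i, f i ∈ F (T.t i)) ∧
      ∑ i, (T.x i.succ - T.x i.castSucc) • f i = x := by
  rw [setRiemannSum, Set.mem_fintype_sum]
  constructor
  · rintro ⟨g, hg, rfl⟩
    choose f hf hfg using fun i => Set.mem_smul_set.1 (hg i)
    exact ⟨f, hf, Finset.sum_congr rfl fun i _ => hfg i⟩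
  · rintro ⟨f, hf, rfl⟩
    exact ⟨_, fun i => Set.smul_mem_smul_set (hf i), rfl⟩

namespace TaggedPartition

theorem length_nonneg (T : TaggedPartition) (i : Fin T.n) :
    0 ≤ T.x i.succ - T.x i.castSucc :=
  sub_nonneg.2 (T.mono i.castSucc_lt_succ.le)

theorem length_le_mesh (T : TaggedPartition) (i : Fin T.n) :
    T.x i.succ - T.x i.castSucc ≤ T.mesh :=
  le_ciSup (f := fun i : Fin T.n => T.x i.succ - T.x i.castSucc) (Set.finite_range _).bddAbove i

theorem mesh_nonneg (T : TaggedPartition) : 0 ≤ T.mesh :=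
  (T.length_nonneg ⟨0, T.npos⟩).trans (T.length_le_mesh _)

theorem sum_length (T : TaggedPartition) : ∑ i : Fin T.n, (T.x i.succ - T.x i.castSucc) = 1 := by
  rw [Finset.sum_sub_distrib]
  have h1 := Fin.sum_univ_succ T.x
  have h2 := Fin.sum_univ_castSucc T.x
  rw [T.x_zero] at h1
  rw [T.x_last] at h2
  linarith

theorem tag_mem_Icc (T : TaggedPartition) (i : Fin T.n) : T.t i ∈ Set.Icc (0 : ℝ) 1 := by
  obtain ⟨h1, h2⟩ := T.tag_mem i
  have h3 := T.mono (Fin.zero_le i.castSucc)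
  have h4 := T.mono (Fin.le_last i.succ)
  rw [T.x_zero] at h3
  rw [T.x_last] at h4
  exact ⟨h3.trans h1, h2.trans h4⟩

theorem sum_rpow_length_le (T : TaggedPartition) {p : ℝ} (hp : 1 < p) :
    ∑ i : Fin T.n, (T.x i.succ - T.x i.castSucc) ^ p ≤ T.mesh ^ (p - 1) := by
  calc ∑ i : Fin T.n, (T.x i.succ - T.x i.castSucc) ^ p
      ≤ ∑ i : Fin T.n, T.mesh ^ (p - 1) * (T.x i.succ - T.x i.castSucc) := by
        refine Finset.sum_le_sum fun i _ => ?_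
        have h0 := T.length_nonneg i
        have : (T.x i.succ - T.x i.castSucc) ^ p = (T.x i.succ - T.x i.castSucc) ^ (p - 1) *
            (T.x i.succ - T.x i.castSucc) := by
          nth_rewrite 3 [← Real.rpow_one (T.x i.succ - T.x i.castSucc)]
          rw [← Real.rpow_add' h0 (by linarith)]
          congr 1
          ring
        rw [this]
        exact mul_le_mul_of_nonneg_right
          (Real.rpow_le_rpow h0 (T.length_le_mesh i) (by linarith)) h0
    _ = T.mesh ^ (p - 1) := by rw [← Finset.mul_sum, T.sum_length, mul_one]

/-- For each `n > 0` and `t ∈ [0,1]`, the partition into `n` equal intervals can be tagged so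
that `t` is one of the tags. -/
theorem exists_uniform_with_tag {n : ℕ} (hn : 0 < n) {t : ℝ} (ht : t ∈ Set.Icc (0 : ℝ) 1) :
    ∃ T : TaggedPartition, (∀ i : Fin T.n, T.x i.succ - T.x i.castSucc = 1 / n) ∧
      ∃ i, T.t i = t := by
  have hn' : (0 : ℝ) < n := by exact_mod_cast hn
  classical
  let T : TaggedPartition :=
    { n := n
      npos := hn
      x := fun i => (i : ℕ) / (n : ℝ)
      t := fun i => if t ∈ Set.Icc ((i : ℕ) / (n : ℝ)) (((i : ℕ) + 1 : ℝ) / (n : ℝ)) then t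
        else (i : ℕ) / (n : ℝ)
      mono := fun i j hij => by
        have : ((i : ℕ) : ℝ) ≤ (j : ℕ) := by exact_mod_cast hij
        exact div_le_div_of_nonneg_right this hn'.le
      x_zero := by simp
      x_last := by simp [hn'.ne']
      tag_mem := fun i => by
        simp only [Fin.val_castSucc, Fin.val_succ, Nat.cast_add, Nat.cast_one]
        split_ifs with h
        · exact h
        · exact ⟨le_rfl, div_le_div_of_nonneg_right (by linarith) hn'.le⟩ }
  refine ⟨T, fun i => ?_, ?_⟩
  · simp only [T, Fin.val_castSucc, Fin.val_succ, Nat.cast_add, Nat.cast_one]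
    ring
  · have key : ∃ i : Fin n,
        t ∈ Set.Icc ((i : ℕ) / (n : ℝ)) (((i : ℕ) + 1 : ℝ) / (n : ℝ)) := by
      rcases eq_or_lt_of_le ht.2 with h | h
      · refine ⟨⟨n - 1, by omega⟩, ?_⟩
        simp only [Nat.cast_sub (show 1 ≤ n from hn), Nat.cast_one, sub_add_cancel]
        rw [Set.mem_Icc, div_le_iff₀ hn', le_div_iff₀ hn', h]
        constructor <;> linarith
      · have htn : 0 ≤ t * n := mul_nonneg ht.1 hn'.le
        refine ⟨⟨⌊t * n⌋₊, (Nat.floor_lt htn).2 (by nlinarith)⟩, ?_⟩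
        rw [Set.mem_Icc, div_le_iff₀ hn', le_div_iff₀ hn']
        exact ⟨Nat.floor_le htn, (Nat.lt_floor_add_one _).le⟩
    obtain ⟨i, hi⟩ := key
    exact ⟨i, if_pos hi⟩

end TaggedPartition

theorem IsMultifunction.convexHull {X : Type*} [NormedAddCommGroup X] [NormedSpace ℝ X]
    {F : ℝ → Set X} (hF : IsMultifunction F) :
    IsMultifunction (fun t => convexHull ℝ (F t)) :=
  fun t ht => ⟨(hF t ht).1.convexHull, isBounded_convexHull.2 (hF t ht).2⟩

theorem IsMultifunction.nonempty_setRiemannSum {X : Type*} [NormedAddCommGroup X]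
    [NormedSpace ℝ X] {F : ℝ → Set X} (hF : IsMultifunction F) (T : TaggedPartition) :
    (setRiemannSum F T).Nonempty := by
  choose f hf using fun i => (hF _ (T.tag_mem_Icc i)).1
  exact ⟨_, mem_setRiemannSum.2 ⟨f, hf, rfl⟩⟩

theorem IsMultifunction.isBounded_setRiemannSum {X : Type*} [NormedAddCommGroup X]
    [NormedSpace ℝ X] {F : ℝ → Set X} (hF : IsMultifunction F) (T : TaggedPartition) :
    Bornology.IsBounded (setRiemannSum F T) := by
  choose M hM using fun i => isBounded_iff_forall_norm_le.1 (hF _ (T.tag_mem_Icc i)).2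
  refine isBounded_iff_forall_norm_le.2
    ⟨∑ i, (T.x i.succ - T.x i.castSucc) * M i, fun x hx => ?_⟩
  obtain ⟨f, hf, rfl⟩ := mem_setRiemannSum.1 hx
  refine (norm_sum_le _ _).trans (Finset.sum_le_sum fun i _ => ?_)
  rw [norm_smul, Real.norm_of_nonneg (T.length_nonneg i)]
  exact mul_le_mul_of_nonneg_left (hM i _ (hf i)) (T.length_nonneg i)

theorem IsSetRiemannIntegral.hausdorffEDist_ne_top {X : Type*} [NormedAddCommGroup X]
    [NormedSpace ℝ X] {F : ℝ → Set X} (hF : IsMultifunction F) {A : Set X}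
    (hA : IsSetRiemannIntegral F A) (T : TaggedPartition) :
    Metric.hausdorffEDist (setRiemannSum F T) A ≠ ⊤ :=
  Metric.hausdorffEDist_ne_top_of_nonempty_of_bounded (hF.nonempty_setRiemannSum T) hA.1
    (hF.isBounded_setRiemannSum T) hA.2.2.1

/-- The values of a Riemann integrable multifunction have uniformly bounded diameters. -/
theorem IsSetRiemannIntegral.exists_diam_bound {X : Type*} [NormedAddCommGroup X]
    [NormedSpace ℝ X] {F : ℝ → Set X} (hF : IsMultifunction F) {A : Set X}
    (hA : IsSetRiemannIntegral F A) :
    ∃ D : ℝ, 0 ≤ D ∧ ∀ t ∈ Set.Icc (0 : ℝ) 1, ∀ x ∈ F t, ∀ y ∈ F t, ‖x - y‖ ≤ D := by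
  obtain ⟨δ, hδ, hT⟩ := hA.2.2.2 1 one_pos
  obtain ⟨M, hM⟩ := isBounded_iff_forall_norm_le.1 hA.2.2.1
  obtain ⟨k, hk⟩ := exists_nat_one_div_lt hδ
  have hk' : (0 : ℝ) < (k + 1 : ℕ) := by positivity
  have main : ∀ t ∈ Set.Icc (0 : ℝ) 1, ∀ x ∈ F t, ∀ y ∈ F t,
      ‖x - y‖ ≤ (k + 1 : ℕ) * (2 * (M + 1)) := by
    intro t ht x hx y hy
    obtain ⟨T, hlen, i, rfl⟩ := TaggedPartition.exists_uniform_with_tag k.succ_pos ht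
    have hmesh : T.mesh < δ := by
      have : Nonempty (Fin T.n) := ⟨i⟩
      simp only [TaggedPartition.mesh, hlen, ciSup_const]
      exact_mod_cast hk
    have hbound : ∀ z ∈ setRiemannSum F T, ‖z‖ ≤ M + 1 := by
      intro z hz
      obtain ⟨a, ha, hd⟩ := Metric.exists_dist_lt_of_hausdorffDist_lt hz (hT T hmesh)
        (hA.hausdorffEDist_ne_top hF T)
      have h1 := hM a ha
      rw [dist_eq_norm] at hd
      have h2 := norm_le_norm_add_norm_sub a z
      rw [norm_sub_rev] at hd
      linarith
    choose f hf using fun i => (hF _ (T.tag_mem_Icc i)).1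
    have hmem : ∀ w ∈ F (T.t i), ∑ j, (T.x j.succ - T.x j.castSucc) • Function.update f i w j ∈
        setRiemannSum F T := by
      intro w hw
      refine mem_setRiemannSum.2 ⟨Function.update f i w, fun j => ?_, rfl⟩
      rcases eq_or_ne j i with rfl | hj
      · simpa using hw
      · simpa [hj] using hf j
    have hdiff : ∑ j, (T.x j.succ - T.x j.castSucc) • Function.update f i x j -
        ∑ j, (T.x j.succ - T.x j.castSucc) • Function.update f i y j =
        (1 / (k + 1 : ℕ) : ℝ) • (x - y) := by
      rw [← Finset.sum_sub_distrib, Finset.sum_eq_single i]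
      · rw [hlen, Function.update_self, Function.update_self, smul_sub]
      · intro j _ hj
        simp [hj]
      · simp
    have h3 := norm_sub_le (∑ j, (T.x j.succ - T.x j.castSucc) • Function.update f i x j)
      (∑ j, (T.x j.succ - T.x j.castSucc) • Function.update f i y j)
    rw [hdiff, norm_smul, Real.norm_of_nonneg (by positivity)] at h3
    have h4 := hbound _ (hmem x hx)
    have h5 := hbound _ (hmem y hy)
    have h6 : 1 / ((k + 1 : ℕ) : ℝ) * ‖x - y‖ ≤ 2 * (M + 1) := by linarith
    rw [one_div, inv_mul_le_iff₀ hk'] at h6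
    exact h6
  refine ⟨max 0 ((k + 1 : ℕ) * (2 * (M + 1))), le_max_left _ _, fun t ht x hx y hy => ?_⟩
  exact (main t ht x hx y hy).trans (le_max_right _ _)

/-- The Riemann sums of `F` and of `conv F` are close when the mesh is small. -/
theorem HasInfratype.hausdorffDist_setRiemannSum_le {X : Type*} [NormedAddCommGroup X]
    [NormedSpace ℝ X] {p C : ℝ} (hp : 1 < p) (hC : 0 < C) (hX : HasInfratype X p C)
    {F : ℝ → Set X} {D : ℝ} (hD : 0 ≤ D)
    (hFD : ∀ t ∈ Set.Icc (0 : ℝ) 1, ∀ x ∈ F t, ∀ y ∈ F t, ‖x - y‖ ≤ D)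
    (T : TaggedPartition) {η : ℝ} (hη : 0 < η) :
    Metric.hausdorffDist (setRiemannSum F T) (setRiemannSum (fun t => convexHull ℝ (F t)) T) ≤
      η + infratypeConvexConst p C * D * (T.mesh ^ (p - 1)) ^ (1 / p) := by
  have hK := (infratypeConvexConst_pos hp hC).1
  have hm := T.mesh_nonneg
  refine Metric.hausdorffDist_le_of_mem_dist (by positivity) ?_ ?_
  · intro x hx
    obtain ⟨f, hf, rfl⟩ := mem_setRiemannSum.1 hx
    refine ⟨_, mem_setRiemannSum.2 ⟨f, fun i => subset_convexHull ℝ _ (hf i), rfl⟩, ?_⟩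
    rw [dist_self]
    positivity
  · intro x hx
    obtain ⟨y, hy, rfl⟩ := mem_setRiemannSum.1 hx
    obtain ⟨f, hf, hle⟩ := hX.exists_near_convexHull hp hC hD (fun i => F (T.t i))
      (fun i => hFD _ (T.tag_mem_Icc i)) (fun i => T.x i.succ - T.x i.castSucc)
      T.length_nonneg y hy hη
    refine ⟨_, mem_setRiemannSum.2 ⟨f, hf, rfl⟩, ?_⟩
    rw [dist_eq_norm, ← Finset.sum_sub_distrib]
    simp only [← smul_sub]
    refine hle.trans ?_
    rw [T.sum_length, mul_one]
    have := Real.rpow_le_rpow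
      (Finset.sum_nonneg fun i _ => Real.rpow_nonneg (T.length_nonneg i) p)
      (T.sum_rpow_length_le hp) (show 0 ≤ 1 / p by positivity)
    gcongr

/-- In a space of infratype `p > 1`, if `conv F` is Riemann integrable with integral `A`,
then `F` itself is Riemann integrable with the same integral `A`. -/
theorem stmt8 {X : Type*} [NormedAddCommGroup X] [NormedSpace ℝ X] [CompleteSpace X]
    (p C : ℝ) (hp : 1 < p) (hC : 0 < C) (hX : HasInfratype X p C)
    (F : ℝ → Set X) (hF : IsMultifunction F) (A : Set X)
    (hFA : IsSetRiemannIntegral (fun t => convexHull ℝ (F t)) A) :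
    IsSetRiemannIntegral F A := by
  obtain ⟨D, hD, hDb⟩ := hFA.exists_diam_bound hF.convexHull
  have hFD : ∀ t ∈ Set.Icc (0 : ℝ) 1, ∀ x ∈ F t, ∀ y ∈ F t, ‖x - y‖ ≤ D := fun t ht x hx y hy =>
    hDb t ht x (subset_convexHull ℝ _ hx) y (subset_convexHull ℝ _ hy)
  refine ⟨hFA.1, hFA.2.1, hFA.2.2.1, fun ε hε => ?_⟩
  obtain ⟨δ₁, hδ₁, h₁⟩ := hFA.2.2.2 (ε / 2) (by positivity)
  have hcont : Continuous
      fun m : ℝ => infratypeConvexConst p C * D * (m ^ (p - 1)) ^ (1 / p) :=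
    continuous_const.mul ((Real.continuous_rpow_const (by positivity)).comp
      (Real.continuous_rpow_const (by linarith)))
  obtain ⟨δ₂, hδ₂, h₂⟩ := Metric.continuous_iff.1 hcont 0 (ε / 4) (by positivity)
  refine ⟨min δ₁ δ₂, lt_min hδ₁ hδ₂, fun T hT => ?_⟩
  have hm := T.mesh_nonneg
  have hsmall := h₂ T.mesh
    (by rw [Real.dist_0_eq_abs, abs_of_nonneg hm]; exact hT.trans_le (min_le_right _ _))
  rw [Real.zero_rpow (by linarith), Real.zero_rpow (by positivity), mul_zero,
    Real.dist_0_eq_abs] at hsmall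
  have hclose := hX.hausdorffDist_setRiemannSum_le hp hC hD hFD T
    (show 0 < ε / 4 by positivity)
  have htri := Metric.hausdorffDist_triangle' (s := setRiemannSum F T)
    (hFA.hausdorffEDist_ne_top hF.convexHull T)
  have := h₁ T (hT.trans_le (min_le_left _ _))
  linarith [le_abs_self (infratypeConvexConst p C * D * (T.mesh ^ (p - 1)) ^ (1 / p))]
end
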